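/- If F = (S, R, M) is an FVR with input length n that is universal in P_k, then for every P ∈ P_k the expected output length satisfies L_P^n(M) ≤ E_P[ log |T(X^n)| ]. Moreover, the FVR F* = (ℤ_{>0}, ρ*, M*) with M*(x^n) = |T(x^n)| and ρ*(x^n) the index of x^n in a fixed enumeration of T(x^n) is universal in P_k and attains this bound with equality: L_P^n(M*) = E_P[ log |T(X^n)| ]. -/

import Mathlib

open Finset

/-- Symbol at (0-indexed) integer position `j` of `x : Fin n → A`, where negative
positions `-k, …, -1` are given by the fixed initial state `s0`. -/
def symAt {A : Type*} [Inhabited A] (k n : ℕ) (s0 : Fin k → A) (x : Fin n → A) (j : ℤ) : A :=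
  if h : 0 ≤ j then
    (if h2 : j.toNat < n then x ⟨j.toNat, h2⟩ else default)
  else
    (if h3 : (j + k).toNat < k then s0 ⟨(j + k).toNat, h3⟩ else default)

/-- The state (context of order `k`) preceding position `t` of `x`. -/
def ctx {A : Type*} [Inhabited A] (k n : ℕ) (s0 : Fin k → A) (x : Fin n → A)
    (t : Fin n) : Fin k → A :=
  fun i => symAt k n s0 x ((t : ℤ) - (k : ℤ) + (i : ℤ))

/-- Probability `P(x^n) = ∏_t p(x_t | x_{t-k}^{t-1})` of the sequence `x`. -/
def seqProb {A : Type*} [Inhabited A] (k n : ℕ) (s0 : Fin k → A)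
    (p : (Fin k → A) → A → ℝ) (x : Fin n → A) : ℝ :=
  ∏ t : Fin n, p (ctx k n s0 x t) (x t)

/-- `p` is a (strictly positive) `k`-th order Markov kernel. -/
def IsMarkov {A : Type*} [Fintype A] (k : ℕ) (p : (Fin k → A) → A → ℝ) : Prop :=
  (∀ s a, 0 < p s a) ∧ ∀ s, ∑ a : A, p s a = 1

/-- `n_{sa}(x)`: number of occurrences of symbol `a` in state `s`. -/
def transCount {A : Type*} [Inhabited A] [DecidableEq A] (k n : ℕ) (s0 : Fin k → A)
    (s : Fin k → A) (a : A) (x : Fin n → A) : ℕ :=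
  (Finset.univ.filter (fun t : Fin n => ctx k n s0 x t = s ∧ x t = a)).card

/-- The type class of `x` with respect to the class of `k`-th order processes. -/
def typeClass {A : Type*} [Fintype A] [Inhabited A] [DecidableEq A] (k n : ℕ)
    (s0 : Fin k → A) (x : Fin n → A) : Finset (Fin n → A) :=
  Finset.univ.filter (fun y => ∀ s a, transCount k n s0 s a y = transCount k n s0 s a x)

/-- The FVR `(S, Rf, Mf)` is perfect for the process `p`: conditioned on
`Mf(X^n) = M0` (whenever this event has positive probability), the output
`Rf(X^n)` is uniformly distributed on `{0, …, M0 - 1}`. -/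
def PerfectFVR {A : Type*} [Fintype A] [Inhabited A] [DecidableEq A] (k n : ℕ)
    (s0 : Fin k → A) (p : (Fin k → A) → A → ℝ) (S : Set ℕ)
    (Mf Rf : (Fin n → A) → ℕ) : Prop :=
  ∀ M0 ∈ S,
    (0 < ∑ x ∈ Finset.univ.filter (fun x : Fin n → A => Mf x = M0), seqProb k n s0 p x) →
    ∀ r < M0,
      (∑ x ∈ Finset.univ.filter (fun x : Fin n → A => Mf x = M0 ∧ Rf x = r),
          seqProb k n s0 p x)
        = (∑ x ∈ Finset.univ.filter (fun x : Fin n → A => Mf x = M0),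
            seqProb k n s0 p x) / (M0 : ℝ)


/-- Expected output length `L_P^n(Mf) = ∑_x P(x) log Mf(x)` (logarithm base 2). -/
noncomputable def expOutLen {A : Type*} [Fintype A] [Inhabited A] [DecidableEq A]
    (k n : ℕ) (s0 : Fin k → A) (p : (Fin k → A) → A → ℝ)
    (Mf : (Fin n → A) → ℕ) : ℝ :=
  ∑ x : Fin n → A, seqProb k n s0 p x * Real.logb 2 (Mf x)

/-- A relation in which two points with a common successor have the same successors, and which is
connected, contains the graph of a cyclic permutation as soon as it contains the graph of some
permutation. -/
theorem exists_cyclic_perm_of_rel {V : Type*} [Finite V] (E : V → V → Prop)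
    (hsib : ∀ s s' t u, E s t → E s' t → E s u → E s' u)
    (hconn : ∀ O : Set V, O.Nonempty → (∀ s ∈ O, ∀ t, E s t → t ∈ O) → O = Set.univ)
    (σ₀ : Equiv.Perm V) (hσ₀ : ∀ s, E s (σ₀ s)) :
    ∃ σ : Equiv.Perm V, (∀ s, E s (σ s)) ∧ ∀ u v, σ.SameCycle u v := by
  classical
  rcases isEmpty_or_nonempty V with hV | ⟨⟨b⟩⟩
  · exact ⟨σ₀, hσ₀, fun u => hV.elim u⟩
  have : Nonempty {σ : Equiv.Perm V // ∀ s, E s (σ s)} := ⟨⟨σ₀, hσ₀⟩⟩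
  obtain ⟨⟨σ, hσ⟩, hmax⟩ := Finite.exists_max
    (fun σ : {σ : Equiv.Perm V // ∀ s, E s (σ s)} => {v | σ.1.SameCycle b v}.ncard)
  suffices h : {v | σ.SameCycle b v} = Set.univ by
    have h' : ∀ v, σ.SameCycle b v := fun v => by
      have : v ∈ {v | σ.SameCycle b v} := h ▸ Set.mem_univ v
      exact this
    exact ⟨σ, hσ, fun u v => (h' u).symm.trans (h' v)⟩
  refine hconn _ ⟨b, Equiv.Perm.SameCycle.refl σ b⟩ fun t ht u htu => ?_
  by_contra hu
  obtain ⟨s, rfl⟩ := σ.surjective u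
  have hs : ¬ σ.SameCycle b s := fun h => hu (Equiv.Perm.sameCycle_apply_right.2 h)
  change σ.SameCycle b t at ht
  set τ : Equiv.Perm V := σ * Equiv.swap t s with hτ
  have hτt : τ t = σ s := by simp [hτ]
  have hτs : τ s = σ t := by simp [hτ]
  have hτo : ∀ v, v ≠ t → v ≠ s → τ v = σ v := fun v h1 h2 => by
    simp [hτ, Equiv.swap_apply_of_ne_of_ne h1 h2]
  have hτE : ∀ v, E v (τ v) := by
    intro v
    by_cases h1 : v = t
    · rw [h1, hτt]; exact htu
    by_cases h2 : v = s
    · rw [h2, hτs]; exact hsib t s _ _ htu (hσ s) (hσ t)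
    rw [hτo v h1 h2]; exact hσ v
  have hrun : ∀ i : ℕ, τ.SameCycle s ((σ ^ (i + 1)) t) := by
    intro i
    induction i with
    | zero =>
      rw [zero_add, pow_one, ← hτs]
      exact Equiv.Perm.sameCycle_apply_right.2 (Equiv.Perm.SameCycle.refl τ s)
    | succ i ih =>
      rw [pow_succ', Equiv.Perm.mul_apply]
      set u := (σ ^ (i + 1)) t with hu'
      have hus : u ≠ s := by
        intro h
        apply hs
        rw [← h, hu', Equiv.Perm.sameCycle_pow_right]
        exact ht
      by_cases hut : u = t
      · rw [hut, ← hτs]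
        exact Equiv.Perm.sameCycle_apply_right.2 (Equiv.Perm.SameCycle.refl τ s)
      · rw [← hτo u hut hus]
        exact Equiv.Perm.sameCycle_apply_right.2 ih
  have hall : ∀ v, σ.SameCycle b v → τ.SameCycle s v := by
    intro v hv
    obtain ⟨i, hi, -, rfl⟩ := (ht.symm.trans hv).exists_pow_eq''
    obtain ⟨j, rfl⟩ := Nat.exists_eq_succ_of_ne_zero hi.ne'
    exact hrun j
  have hb : τ.SameCycle s b := hall b (Equiv.Perm.SameCycle.refl σ b)
  have hlt : {v | σ.SameCycle b v}.ncard < {v | τ.SameCycle b v}.ncard := by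
    apply Set.ncard_lt_ncard _ (Set.toFinite _)
    refine ⟨fun v hv => hb.symm.trans (hall v hv), fun h => hs (h hb.symm)⟩
  exact absurd (hmax ⟨τ, hτE⟩) (not_le.2 hlt)

/-- The state reached from the state `s` after reading the symbol `a`. -/
def nextState {A : Type*} {k : ℕ} (s : Fin k → A) (a : A) : Fin k → A :=
  fun i => if h : (i : ℕ) + 1 < k then s ⟨i + 1, h⟩ else a

theorem nextState_congr {A : Type*} {k : ℕ} {s s' : Fin k → A} {a a' : A}
    (h : nextState s a = nextState s' a') (c : A) : nextState s c = nextState s' c := by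
  funext i
  have hi := congrFun h i
  unfold nextState at hi ⊢
  split_ifs at hi ⊢ with h1
  · exact hi
  · rfl

theorem eq_univ_of_nextState_mem {A : Type*} {k : ℕ} (O : Set (Fin k → A)) (hne : O.Nonempty)
    (hO : ∀ s ∈ O, ∀ a, nextState s a ∈ O) : O = Set.univ := by
  refine Set.eq_univ_of_forall fun t => ?_
  have key : ∀ j, j ≤ k → ∃ s ∈ O, ∀ i m : Fin k, (i : ℕ) + j = m + k → s i = t m := by
    intro j
    induction j with
    | zero =>
      intro _
      obtain ⟨s, hs⟩ := hne
      exact ⟨s, hs, fun i m h => by omega⟩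
    | succ j ih =>
      intro hj
      obtain ⟨s, hs, hst⟩ := ih (by omega)
      refine ⟨nextState s (t ⟨j, hj⟩), hO s hs _, fun i m h => ?_⟩
      unfold nextState
      split_ifs with h1
      · exact hst _ m (by simp only; omega)
      · congr 1
        ext
        simp only
        omega
  obtain ⟨s, hs, hst⟩ := key k le_rfl
  have : s = t := funext fun i => hst i i rfl
  exact this ▸ hs

theorem exists_nextState_eq_comp_finRotate {A : Type*} [Nonempty A] {k : ℕ} (s : Fin k → A) :
    ∃ a, s ∘ finRotate k = nextState s a := by
  cases k with
  | zero => exact ⟨Classical.arbitrary A, funext fun i => i.elim0⟩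
  | succ k =>
    refine ⟨s 0, funext fun i => ?_⟩
    unfold nextState
    split_ifs with h
    · rw [Function.comp_apply, finRotate_of_lt (by omega)]
    · obtain rfl : i = Fin.last k := by ext; simp; omega
      rw [Function.comp_apply, finRotate_last]

/-- The de Bruijn graph is Hamiltonian. -/
theorem exists_cyclic_perm_nextState {A : Type*} [Finite A] [Nonempty A] (k : ℕ) :
    ∃ (a : (Fin k → A) → A) (σ : Equiv.Perm (Fin k → A)),
      (∀ s, σ s = nextState s (a s)) ∧ ∀ u v, σ.SameCycle u v := by
  obtain ⟨σ, hσ, hc⟩ := exists_cyclic_perm_of_rel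
    (fun s t : Fin k → A => ∃ a, t = nextState s a)
    (by
      rintro s s' t u ⟨a, rfl⟩ ⟨a', h⟩ ⟨c, rfl⟩
      exact ⟨c, nextState_congr h c⟩)
    (fun O hne hO => eq_univ_of_nextState_mem O hne fun s hs a => hO s hs _ ⟨a, rfl⟩)
    ((finRotate k).symm.arrowCongr (Equiv.refl A))
    (fun s => exists_nextState_eq_comp_finRotate s)
  choose a ha using hσ
  exact ⟨a, σ, ha, hc⟩

/-- A cyclic permutation of a finite type is conjugate to a translation of a cyclic group. -/
theorem exists_zmod_coordinate {V : Type*} [Finite V] (σ : Equiv.Perm V)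
    (hc : ∀ u v, σ.SameCycle u v) :
    ∃ (N : ℕ) (φ : V → ZMod N), Function.Injective φ ∧ ∀ v, φ (σ v) = φ v + 1 := by
  rcases isEmpty_or_nonempty V with hV | ⟨⟨b⟩⟩
  · exact ⟨0, fun v => hV.elim v, fun v => hV.elim v, fun v => hV.elim v⟩
  choose i hi using fun v => hc b v
  have hpow : ∀ m : ℤ, (σ ^ m) b = b → σ ^ m = 1 := by
    intro m hm
    ext v
    rw [← hi v, ← Equiv.Perm.mul_apply, ← zpow_add, add_comm, zpow_add, Equiv.Perm.mul_apply, hm]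
    rfl
  refine ⟨orderOf σ, fun v => (i v : ZMod (orderOf σ)), fun v w hvw => ?_, fun v => ?_⟩
  · have h := (ZMod.intCast_eq_intCast_iff_dvd_sub _ _ _).1 hvw
    rw [orderOf_dvd_iff_zpow_eq_one] at h
    rw [← hi v, ← hi w, ← sub_add_cancel (i w) (i v), zpow_add, h, one_mul]
  · have h : ((i v + 1 : ℤ) : ZMod (orderOf σ)) = ((i (σ v) : ℤ) : ZMod (orderOf σ)) := by
      rw [ZMod.intCast_eq_intCast_iff_dvd_sub, orderOf_dvd_iff_zpow_eq_one]
      apply hpow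
      have h1 : (σ ^ i (σ v)) b = (σ ^ (i v + 1)) b := by
        rw [hi, add_comm, zpow_add, Equiv.Perm.mul_apply, hi, zpow_one]
      rw [sub_eq_neg_add, zpow_add, Equiv.Perm.mul_apply, h1, ← Equiv.Perm.mul_apply, ← zpow_add,
        neg_add_cancel, zpow_zero, Equiv.Perm.one_apply]
    simpa using h.symm

section Markov

open Filter Topology

/-- Functions with values at most `n` are separated by a single positive integer weight. -/
theorem exists_separating_weight (ι : Type*) [Fintype ι] (n : ℕ) :
    ∃ m : ι → ℕ, (∀ i, m i ≠ 0) ∧ ∀ f g : ι → ℕ, (∀ i, f i ≤ n) → (∀ i, g i ≤ n) →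
      ∑ i, m i * f i = ∑ i, m i * g i → f = g := by
  set e := Fintype.equivFin ι
  refine ⟨fun i => (n + 1) ^ (e i : ℕ), fun i => by positivity, fun f g hf hg hfg => ?_⟩
  have key : ∀ (f : ι → ℕ) (hf : ∀ i, f i ≤ n), ∑ i, (n + 1) ^ (e i : ℕ) * f i =
      (finFunctionFinEquiv fun j => (⟨f (e.symm j), Nat.lt_succ_of_le (hf _)⟩ : Fin (n + 1)) :
        Fin _) := by
    intro f hf
    rw [finFunctionFinEquiv_apply, ← e.sum_comp]
    simp [mul_comm]
  rw [key f hf, key g hg, Fin.val_inj, finFunctionFinEquiv.apply_eq_iff_eq] at hfg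
  funext i
  simpa using congrArg Fin.val (congrFun hfg (e i))

/-- If a combination of terms `ε ^ w y * u y ε`, with `u y ε → 1` and `u y` depending only on
`w y`, vanishes for small `ε > 0`, then the coefficients at each exponent sum to zero. -/
theorem sum_coeff_eq_zero_of_eventually {Y : Type*} [Fintype Y] (c : Y → ℝ) (w : Y → ℕ)
    (u : Y → ℝ → ℝ) (hu : ∀ y, Tendsto (u y) (𝓝[>] 0) (𝓝 1))
    (huw : ∀ y z, w y = w z → u y = u z)
    (h : ∀ᶠ ε in 𝓝[>] (0 : ℝ), ∑ y, c y * (ε ^ w y * u y ε) = 0) (j : ℕ) :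
    ∑ y with w y = j, c y = 0 := by
  induction j using Nat.strong_induction_on with
  | _ j ih =>
  have hlow : ∀ ε : ℝ, ∑ y with w y < j, c y * (ε ^ w y * u y ε) = 0 := by
    intro ε
    rw [← Finset.sum_fiberwise_of_maps_to (t := Finset.range j) (g := w)
      (fun y hy => Finset.mem_range.2 (Finset.mem_filter.1 hy).2)]
    refine Finset.sum_eq_zero fun i hi => ?_
    have hij := Finset.mem_range.1 hi
    have hf : (univ.filter fun y => w y < j).filter (fun y => w y = i)
        = univ.filter fun y => w y = i := by
      ext y
      simp only [Finset.mem_filter, Finset.mem_univ, true_and]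
      exact ⟨fun h => h.2, fun h => ⟨h ▸ hij, h⟩⟩
    rw [hf]
    rcases (univ.filter fun y => w y = i).eq_empty_or_nonempty with h0 | ⟨z, hz⟩
    · rw [h0, Finset.sum_empty]
    · have hz' := (Finset.mem_filter.1 hz).2
      rw [Finset.sum_congr rfl (g := fun y => c y * (ε ^ i * u z ε)), ← Finset.sum_mul, ih i hij,
        zero_mul]
      intro y hy
      have hy' := (Finset.mem_filter.1 hy).2
      rw [hy', huw y z (hy'.trans hz'.symm)]
  have hterm : ∀ y, Tendsto (fun ε : ℝ => if j ≤ w y then c y * (ε ^ (w y - j) * u y ε) else 0)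
      (𝓝[>] 0) (𝓝 (if w y = j then c y else 0)) := by
    intro y
    rcases lt_trichotomy (w y) j with hy | hy | hy
    · simp [hy.not_ge, hy.ne]
    · simpa [hy] using (hu y).const_mul (c y)
    · have hpow : Tendsto (fun ε : ℝ => ε ^ (w y - j)) (𝓝[>] 0) (𝓝 0) := by
        have : Tendsto (fun ε : ℝ => ε ^ (w y - j)) (𝓝 0) (𝓝 (0 ^ (w y - j))) :=
          (continuous_pow _).tendsto 0
        rw [zero_pow (by omega)] at this
        exact this.mono_left nhdsWithin_le_nhds
      simpa [hy.le, hy.ne'] using (hpow.mul (hu y)).const_mul (c y)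
  have hlim := tendsto_finsetSum univ fun y _ => hterm y
  rw [Finset.sum_filter]
  refine tendsto_nhds_unique hlim (tendsto_const_nhds.congr' ?_)
  filter_upwards [h, self_mem_nhdsWithin] with ε hε hpos
  have hpos' : ε ^ j ≠ 0 := pow_ne_zero _ (ne_of_gt hpos)
  apply mul_left_cancel₀ hpos'
  rw [mul_zero]
  refine hε.symm.trans ?_
  rw [← Finset.sum_filter_add_sum_filter_not univ (fun y => w y < j), hlow ε,
    zero_add, Finset.sum_filter, Finset.mul_sum]
  refine Finset.sum_congr rfl fun y _ => ?_
  by_cases hy : w y < j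
  · simp [hy, hy.not_ge]
  · have hy' := not_lt.1 hy
    rw [if_pos hy', if_pos hy, ← Nat.sub_add_cancel hy', pow_add, Nat.add_sub_cancel]
    ring

section Kernel

variable {A : Type*} [Fintype A] [DecidableEq A] {k : ℕ}

/-- The kernel that in state `s` emits `a ≠ c s` with probability `ε ^ m s a`, and otherwise emits
`c s`. -/
noncomputable def perturbedKernel (c : (Fin k → A) → A) (m : (Fin k → A) → A → ℕ) (ε : ℝ) :
    (Fin k → A) → A → ℝ :=
  fun s a => if a = c s then 1 - ∑ b ∈ univ.erase (c s), ε ^ m s b else ε ^ m s a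

theorem tendsto_perturbedKernel_self (c : (Fin k → A) → A) {m : (Fin k → A) → A → ℕ}
    (hm : ∀ s a, m s a ≠ 0) (s : Fin k → A) :
    Tendsto (fun ε => perturbedKernel c m ε s (c s)) (𝓝[>] 0) (𝓝 1) := by
  have hcont : Continuous fun ε : ℝ => perturbedKernel c m ε s (c s) := by
    simp only [perturbedKernel, if_true]
    fun_prop
  have h := hcont.tendsto 0
  have h0 : perturbedKernel c m 0 s (c s) = 1 := by
    simp [perturbedKernel, hm]
  rw [h0] at h
  exact h.mono_left nhdsWithin_le_nhds

theorem eventually_isMarkov_perturbedKernel (c : (Fin k → A) → A) {m : (Fin k → A) → A → ℕ}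
    (hm : ∀ s a, m s a ≠ 0) :
    ∀ᶠ ε in 𝓝[>] (0 : ℝ), IsMarkov k (perturbedKernel c m ε) := by
  have h : ∀ᶠ ε in 𝓝[>] (0 : ℝ), ∀ s, 0 < perturbedKernel c m ε s (c s) :=
    eventually_all.2 fun s => (tendsto_perturbedKernel_self c hm s).eventually_const_lt one_pos
  filter_upwards [h, self_mem_nhdsWithin] with ε hε hpos
  refine ⟨fun s a => ?_, fun s => ?_⟩
  · by_cases ha : a = c s
    · rw [ha]; exact hε s
    · rw [perturbedKernel, if_neg ha]; exact pow_pos hpos _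
  · rw [← Finset.add_sum_erase univ _ (Finset.mem_univ (c s)),
      Finset.sum_congr rfl (g := fun b => ε ^ m s b)]
    · simp [perturbedKernel]
    · intro b hb
      rw [perturbedKernel, if_neg (Finset.ne_of_mem_erase hb)]

end Kernel

variable {A : Type*} [Inhabited A] {k n : ℕ} {s0 : Fin k → A}

/-- The state after the first `t` symbols of `x`. -/
def stateAt (s0 : Fin k → A) (x : Fin n → A) (t : ℕ) : Fin k → A :=
  fun i => symAt k n s0 x ((t : ℤ) - (k : ℤ) + (i : ℤ))

theorem stateAt_zero (x : Fin n → A) : stateAt s0 x 0 = s0 := by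
  funext i
  have h := i.2
  have h1 : ¬ (0 : ℤ) ≤ ((0 : ℕ) : ℤ) - (k : ℤ) + ((i : ℕ) : ℤ) := by omega
  have h2 : (((0 : ℕ) : ℤ) - (k : ℤ) + ((i : ℕ) : ℤ) + k).toNat = i := by omega
  simp only [stateAt, symAt, dif_neg h1, h2, dif_pos h]

theorem stateAt_succ (x : Fin n → A) (t : Fin n) :
    stateAt s0 x (t + 1) = nextState (ctx k n s0 x t) (x t) := by
  funext i
  unfold nextState ctx stateAt
  split_ifs with h
  · congr 1
    push_cast
    ring
  · have h1 : (((t : ℕ) + 1 : ℕ) : ℤ) - (k : ℤ) + ((i : ℕ) : ℤ) = (t : ℕ) := by omega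
    rw [h1]
    simp [symAt]

theorem sum_nextState_sub {G : Type*} [AddCommGroup G] (x : Fin n → A) (g : (Fin k → A) → G) :
    ∑ t, (g (nextState (ctx k n s0 x t) (x t)) - g (ctx k n s0 x t))
      = g (stateAt s0 x n) - g s0 := by
  have h : ∀ t : Fin n, g (nextState (ctx k n s0 x t) (x t)) - g (ctx k n s0 x t)
      = (fun t : ℕ => g (stateAt s0 x (t + 1)) - g (stateAt s0 x t)) t := fun t => by
    rw [← stateAt_succ]; rfl
  rw [Finset.sum_congr rfl fun t _ => h t,
    Fin.sum_univ_eq_sum_range (fun t : ℕ => g (stateAt s0 x (t + 1)) - g (stateAt s0 x t)) n,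
    Finset.sum_range_sub (fun t => g (stateAt s0 x t)), stateAt_zero]

theorem seqProb_pos [Fintype A] {p : (Fin k → A) → A → ℝ} (hp : IsMarkov k p) (x : Fin n → A) :
    0 < seqProb k n s0 p x :=
  Finset.prod_pos fun _ _ => hp.1 _ _

variable [DecidableEq A] [Fintype A]

theorem prod_ctx_eq {M : Type*} [CommMonoid M] (x : Fin n → A) (h : (Fin k → A) → A → M) :
    ∏ t, h (ctx k n s0 x t) (x t) = ∏ s, ∏ a, h s a ^ transCount k n s0 s a x := by
  have := Finset.prod_fiberwise' (univ : Finset (Fin n)) (fun t => (ctx k n s0 x t, x t))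
    (fun q => h q.1 q.2)
  rw [← this, Fintype.prod_prod_type]
  simp only [Finset.prod_const, transCount, Prod.mk.injEq]

theorem sum_ctx_eq {M : Type*} [AddCommMonoid M] (x : Fin n → A) (h : (Fin k → A) → A → M) :
    ∑ t, h (ctx k n s0 x t) (x t) = ∑ s, ∑ a, transCount k n s0 s a x • h s a := by
  have := Finset.sum_fiberwise' (univ : Finset (Fin n)) (fun t => (ctx k n s0 x t, x t))
    (fun q => h q.1 q.2)
  rw [← this, Fintype.sum_prod_type]
  simp only [Finset.sum_const, transCount, Prod.mk.injEq]

/-- Transition counts are determined by the counts off a Hamiltonian cycle. -/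
theorem transCount_eq_of_off_cycle (c : (Fin k → A) → A) (σ : Equiv.Perm (Fin k → A))
    (hσ : ∀ s, σ s = nextState s (c s)) (hc : ∀ u v, σ.SameCycle u v) (x y : Fin n → A)
    (hxy : ∀ s a, a ≠ c s → transCount k n s0 s a x = transCount k n s0 s a y) (s : Fin k → A)
    (a : A) : transCount k n s0 s a x = transCount k n s0 s a y := by
  set d : (Fin k → A) → ℤ := fun s =>
    (transCount k n s0 s (c s) x : ℤ) - transCount k n s0 s (c s) y with hd
  have hdiff : ∀ {G : Type} [AddCommGroup G] (h : (Fin k → A) → A → G),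
      ∑ t, h (ctx k n s0 x t) (x t) - ∑ t, h (ctx k n s0 y t) (y t) = ∑ s, d s • h s (c s) := by
    intro G _ h
    rw [sum_ctx_eq, sum_ctx_eq, ← Finset.sum_sub_distrib]
    refine Finset.sum_congr rfl fun s _ => ?_
    rw [← Finset.sum_sub_distrib, Finset.sum_eq_single (c s)]
    · rw [hd, sub_smul, natCast_zsmul, natCast_zsmul]
    · intro a _ ha
      rw [hxy s a ha, sub_self]
    · simp
  have hsum : ∑ s, d s = 0 := by
    have := hdiff (fun _ _ => (1 : ℤ))
    simpa using this.symm
  have hflow : ∀ {G : Type} [AddCommGroup G] (g : (Fin k → A) → G),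
      g (stateAt s0 x n) - g (stateAt s0 y n) = ∑ s, d s • (g (σ s) - g s) := by
    intro G _ g
    have := hdiff (fun s a => g (nextState s a) - g s)
    rw [sum_nextState_sub, sum_nextState_sub, sub_sub_sub_cancel_right] at this
    rw [this]
    simp only [hσ]
  have hfin : stateAt s0 x n = stateAt s0 y n := by
    obtain ⟨N, φ, hφ, hφσ⟩ := exists_zmod_coordinate σ hc
    apply hφ
    rw [← sub_eq_zero, hflow φ]
    simp only [hφσ, add_sub_cancel_left, ← Finset.sum_smul, hsum, zero_smul]
  have hstep : ∀ v, d (σ v) = d v := by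
    intro v
    have := hflow (fun s => if s = σ v then (1 : ℤ) else 0)
    rw [hfin, sub_self] at this
    simp only [smul_eq_mul, mul_sub, Finset.sum_sub_distrib, σ.injective.eq_iff, mul_ite, mul_one,
      mul_zero, Finset.sum_ite_eq', Finset.mem_univ, if_true] at this
    omega
  have hconst : ∀ u v, d u = d v := by
    intro u v
    obtain ⟨i, rfl⟩ := (hc u v).exists_nat_pow_eq
    induction i with
    | zero => rfl
    | succ i ih => rw [pow_succ', Equiv.Perm.mul_apply, hstep, ih]
  by_cases ha : a = c s
  · have h0 : d s = 0 := by
      rw [Finset.sum_congr rfl fun v _ => hconst v s, Finset.sum_const, Finset.card_univ,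
        smul_eq_zero] at hsum
      exact hsum.resolve_left Fintype.card_ne_zero
    rw [ha]
    have : (transCount k n s0 s (c s) x : ℤ) - transCount k n s0 s (c s) y = 0 := h0
    omega
  · exact hxy s a ha

theorem seqProb_perturbedKernel (c : (Fin k → A) → A) (m : (Fin k → A) → A → ℕ) (ε : ℝ)
    (x : Fin n → A) :
    seqProb k n s0 (perturbedKernel c m ε) x =
      ε ^ (∑ q : (Fin k → A) × A,
          m q.1 q.2 * if q.2 = c q.1 then 0 else transCount k n s0 q.1 q.2 x) *
        ∏ s, perturbedKernel c m ε s (c s) ^ transCount k n s0 s (c s) x := by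
  rw [seqProb, prod_ctx_eq, Fintype.sum_prod_type, ← Finset.prod_pow_eq_pow_sum,
    ← Finset.prod_mul_distrib]
  refine Finset.prod_congr rfl fun s _ => ?_
  rw [← Finset.mul_prod_erase univ _ (Finset.mem_univ (c s)), mul_comm,
    ← Finset.prod_pow_eq_pow_sum, ← Finset.mul_prod_erase univ _ (Finset.mem_univ (c s))]
  simp only [if_true, mul_zero, pow_zero, one_mul]
  congr 1
  refine Finset.prod_congr rfl fun a ha => ?_
  have ha' := Finset.ne_of_mem_erase ha
  rw [if_neg ha', perturbedKernel, if_neg ha', pow_mul]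

theorem mem_typeClass {x y : Fin n → A} :
    y ∈ typeClass k n s0 x ↔ ∀ s a, transCount k n s0 s a y = transCount k n s0 s a x := by
  simp [typeClass]

/-- The probabilities of the distinct type classes are linearly independent functions of the
process. -/
theorem sum_typeClass_eq_zero (c : (Fin n → A) → ℝ)
    (hc : ∀ p : (Fin k → A) → A → ℝ, IsMarkov k p → ∑ y, c y * seqProb k n s0 p y = 0)
    (x : Fin n → A) : ∑ y ∈ typeClass k n s0 x, c y = 0 := by
  obtain ⟨b, σ, hσ, hcyc⟩ := exists_cyclic_perm_nextState (A := A) k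
  obtain ⟨m, hm, hsep⟩ := exists_separating_weight ((Fin k → A) × A) n
  set w : (Fin n → A) → ℕ := fun y => ∑ q : (Fin k → A) × A,
    m q * if q.2 = b q.1 then 0 else transCount k n s0 q.1 q.2 y with hw
  have hle : ∀ (y : Fin n → A) (s a), transCount k n s0 s a y ≤ n := fun y s a =>
    (Finset.card_filter_le _ _).trans (by simp)
  have htype : ∀ y z, w y = w z → ∀ s a, transCount k n s0 s a y = transCount k n s0 s a z := by
    intro y z hyz
    have hfun := hsep _ _
      (fun q => by split_ifs; exacts [Nat.zero_le _, hle y q.1 q.2])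
      (fun q => by split_ifs; exacts [Nat.zero_le _, hle z q.1 q.2]) hyz
    refine transCount_eq_of_off_cycle b σ hσ hcyc y z fun s a ha => ?_
    simpa [ha] using congrFun hfun (s, a)
  have hfilter : typeClass k n s0 x = univ.filter fun y => w y = w x := by
    ext y
    rw [mem_typeClass, Finset.mem_filter]
    refine ⟨fun h => ⟨Finset.mem_univ _, ?_⟩, fun h => htype y x h.2⟩
    simp only [hw, h]
  rw [hfilter]
  refine sum_coeff_eq_zero_of_eventually c w
    (fun y ε => ∏ s, perturbedKernel b (fun s a => m (s, a)) ε s (b s) ^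
      transCount k n s0 s (b s) y)
    (fun y => ?_) (fun y z hyz => ?_) ?_ (w x)
  · simpa using tendsto_finsetProd univ fun s _ =>
      (tendsto_perturbedKernel_self b (m := fun s a => m (s, a)) (fun _ _ => hm _) s).pow
        (transCount k n s0 s (b s) y)
  · funext ε
    simp only [htype y z hyz]
  · filter_upwards [eventually_isMarkov_perturbedKernel b (m := fun s a => m (s, a))
      (fun _ _ => hm _)] with ε hε
    rw [← hc _ hε]
    exact Finset.sum_congr rfl fun y _ => by rw [seqProb_perturbedKernel]

theorem seqProb_eq_of_mem_typeClass (p : (Fin k → A) → A → ℝ) {x y : Fin n → A}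
    (h : y ∈ typeClass k n s0 x) : seqProb k n s0 p y = seqProb k n s0 p x := by
  rw [seqProb, seqProb, prod_ctx_eq, prod_ctx_eq]
  simp only [mem_typeClass.1 h]

theorem self_mem_typeClass (x : Fin n → A) : x ∈ typeClass k n s0 x :=
  mem_typeClass.2 fun _ _ => rfl

theorem typeClass_eq_of_mem {x y : Fin n → A} (h : y ∈ typeClass k n s0 x) :
    typeClass k n s0 y = typeClass k n s0 x := by
  ext z
  simp only [mem_typeClass, mem_typeClass.1 h]

/-- The output range of a universal FVR at `x` is at most the size of the type class of `x`. -/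
theorem le_card_typeClass_of_universal {S : Set ℕ} {Mf Rf : (Fin n → A) → ℕ}
    (hMS : ∀ x, Mf x ∈ S) (hRM : ∀ x, Rf x < Mf x)
    (huniv : ∀ p : (Fin k → A) → A → ℝ, IsMarkov k p → PerfectFVR k n s0 p S Mf Rf)
    (x : Fin n → A) : Mf x ≤ (typeClass k n s0 x).card := by
  have hpos : (0 : ℝ) < Mf x := by exact_mod_cast (Nat.zero_le _).trans_lt (hRM x)
  have hzero := sum_typeClass_eq_zero (s0 := s0)
    (fun y => (Mf x : ℝ) * (if Mf y = Mf x ∧ Rf y = Rf x then 1 else 0)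
      - if Mf y = Mf x then 1 else 0) (fun p hp => ?_) x
  · rw [Finset.sum_sub_distrib, ← Finset.mul_sum, Finset.sum_boole, Finset.sum_boole,
      sub_eq_zero] at hzero
    have hzero' : Mf x * #{y ∈ typeClass k n s0 x | Mf y = Mf x ∧ Rf y = Rf x}
        = #{y ∈ typeClass k n s0 x | Mf y = Mf x} := by exact_mod_cast hzero
    have hone : 0 < #{y ∈ typeClass k n s0 x | Mf y = Mf x ∧ Rf y = Rf x} :=
      Finset.card_pos.2 ⟨x, Finset.mem_filter.2 ⟨self_mem_typeClass x, rfl, rfl⟩⟩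
    calc Mf x ≤ Mf x * #{y ∈ typeClass k n s0 x | Mf y = Mf x ∧ Rf y = Rf x} :=
          Nat.le_mul_of_pos_right _ hone
      _ = #{y ∈ typeClass k n s0 x | Mf y = Mf x} := hzero'
      _ ≤ (typeClass k n s0 x).card := Finset.card_filter_le _ _
  · have hperf := huniv p hp (Mf x) (hMS x)
      (Finset.sum_pos (fun y _ => seqProb_pos hp y) ⟨x, by simp⟩) (Rf x) (hRM x)
    rw [eq_div_iff hpos.ne', Finset.sum_filter, Finset.sum_filter] at hperf
    simp only [sub_mul, mul_assoc, ite_mul, one_mul, zero_mul, Finset.sum_sub_distrib,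
      ← Finset.mul_sum]
    rw [← hperf]
    ring

/-- The index of a sequence in an enumeration of its type class. -/
noncomputable def typeIndex (s0 : Fin k → A) (x : Fin n → A) : ℕ :=
  (typeClass k n s0 x).toList.idxOf x

theorem typeIndex_lt (x : Fin n → A) : typeIndex s0 x < (typeClass k n s0 x).card := by
  rw [typeIndex, ← Finset.length_toList]
  exact List.idxOf_lt_length_of_mem (Finset.mem_toList.2 (self_mem_typeClass x))

theorem eq_of_typeIndex_eq {x y : Fin n → A} (hy : y ∈ typeClass k n s0 x)
    (h : typeIndex s0 y = typeIndex s0 x) : y = x := by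
  rw [typeIndex, typeIndex, typeClass_eq_of_mem hy] at h
  exact (List.idxOf_inj (Finset.mem_toList.2 hy)).1 h

theorem exists_mem_typeClass_typeIndex_eq (x : Fin n → A) {r : ℕ}
    (hr : r < (typeClass k n s0 x).card) : ∃ y ∈ typeClass k n s0 x, typeIndex s0 y = r := by
  rw [← Finset.length_toList] at hr
  have hmem : (typeClass k n s0 x).toList[r] ∈ typeClass k n s0 x :=
    Finset.mem_toList.1 (List.getElem_mem hr)
  refine ⟨_, hmem, ?_⟩
  rw [typeIndex, typeClass_eq_of_mem hmem]
  exact (Finset.nodup_toList _).idxOf_getElem r hr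

theorem perfectFVR_typeIndex (p : (Fin k → A) → A → ℝ) :
    PerfectFVR k n s0 p {m : ℕ | 0 < m} (fun x => (typeClass k n s0 x).card) (typeIndex s0) := by
  intro M hM _ r hr
  have hM' : (M : ℝ) ≠ 0 := Nat.cast_ne_zero.2 (ne_of_gt hM)
  rw [eq_div_iff hM', Finset.sum_mul]
  calc ∑ y with (typeClass k n s0 y).card = M ∧ typeIndex s0 y = r, seqProb k n s0 p y * M
      = ∑ y with (typeClass k n s0 y).card = M ∧ typeIndex s0 y = r,
          ∑ x ∈ typeClass k n s0 y, seqProb k n s0 p x := by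
        refine Finset.sum_congr rfl fun y hy => ?_
        rw [Finset.sum_congr rfl fun x hx => seqProb_eq_of_mem_typeClass p hx, Finset.sum_const,
          (Finset.mem_filter.1 hy).2.1, nsmul_eq_mul, mul_comm]
    _ = ∑ x with (typeClass k n s0 x).card = M,
          ∑ y ∈ typeClass k n s0 x with typeIndex s0 y = r, seqProb k n s0 p x := by
        refine Finset.sum_comm' fun y x => ?_
        simp only [Finset.mem_filter, Finset.mem_univ, true_and]
        constructor
        · rintro ⟨⟨h1, h2⟩, h3⟩
          have h4 := typeClass_eq_of_mem h3
          exact ⟨⟨h4 ▸ self_mem_typeClass y, h2⟩, h4 ▸ h1⟩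
        · rintro ⟨⟨h1, h2⟩, h3⟩
          have h4 := typeClass_eq_of_mem h1
          exact ⟨⟨h4 ▸ h3, h2⟩, h4 ▸ self_mem_typeClass x⟩
    _ = ∑ x with (typeClass k n s0 x).card = M, seqProb k n s0 p x := by
        refine Finset.sum_congr rfl fun x hx => ?_
        obtain ⟨y, hy, hyr⟩ := exists_mem_typeClass_typeIndex_eq (s0 := s0) x
          (hr.trans_eq (Finset.mem_filter.1 hx).2.symm)
        have hsingle : {z ∈ typeClass k n s0 x | typeIndex s0 z = r} = {y} := by
          ext z
          rw [Finset.mem_filter, Finset.mem_singleton]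
          refine ⟨fun h => eq_of_typeIndex_eq ?_ (h.2.trans hyr.symm), fun h => h ▸ ⟨hy, hyr⟩⟩
          rw [typeClass_eq_of_mem hy]
          exact h.1
        rw [hsingle, Finset.sum_singleton]

end Markov

/-- Any universal FVR has expected output length at most
`E_P[log |T(X^n)|]`; moreover the Elias FVR `F* = (ℤ_{>0}, ρ*, M*)`, where
`M*(x) = |T(x)|` and `ρ*` enumerates each type class, is universal and attains
this bound with equality. -/
theorem universal_fvr_expected_length_bound {A : Type*} [Fintype A] [DecidableEq A]
    [Inhabited A] (hA : 2 ≤ Fintype.card A) (k n : ℕ) (s0 : Fin k → A)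
    (S : Set ℕ) (hSpos : ∀ m ∈ S, 0 < m) (hS1 : 1 ∈ S)
    (Mf Rf : (Fin n → A) → ℕ)
    (hMS : ∀ x, Mf x ∈ S) (hRM : ∀ x, Rf x < Mf x)
    (huniv : ∀ p : (Fin k → A) → A → ℝ, IsMarkov k p → PerfectFVR k n s0 p S Mf Rf) :
    (∀ p : (Fin k → A) → A → ℝ, IsMarkov k p →
      expOutLen k n s0 p Mf
        ≤ ∑ x : Fin n → A,
            seqProb k n s0 p x * Real.logb 2 ((typeClass k n s0 x).card)) ∧
    ∃ Rs : (Fin n → A) → ℕ,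
      (∀ x, Rs x < (typeClass k n s0 x).card) ∧
      (∀ x y, y ∈ typeClass k n s0 x → Rs y = Rs x → y = x) ∧
      (∀ p : (Fin k → A) → A → ℝ, IsMarkov k p →
        PerfectFVR k n s0 p {m : ℕ | 0 < m} (fun x => (typeClass k n s0 x).card) Rs) ∧
      (∀ p : (Fin k → A) → A → ℝ, IsMarkov k p →
        expOutLen k n s0 p (fun x => (typeClass k n s0 x).card)
          = ∑ x : Fin n → A,
              seqProb k n s0 p x * Real.logb 2 ((typeClass k n s0 x).card)) := by
  refine ⟨fun p hp => Finset.sum_le_sum fun x _ => ?_, typeIndex s0, typeIndex_lt,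
    fun x y hy h => eq_of_typeIndex_eq hy h, fun p _ => perfectFVR_typeIndex p, fun p _ => rfl⟩
  refine mul_le_mul_of_nonneg_left ?_ (seqProb_pos hp x).le
  refine Real.logb_le_logb_of_le one_lt_two ?_ ?_
  · exact_mod_cast (Nat.zero_le _).trans_lt (hRM x)
  · exact_mod_cast le_card_typeClass_of_universal hMS hRM huniv x
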